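/- Let μ = μ₁⊗⋯⊗μₙ with each μᵢ ∈ M(h,λ), and C_τ = 17h/(1−λ)². Let f: ℝⁿ → ℝ be convex with |f(x)−f(y)| ≤ a|x−y|₂ and |f(x)−f(y)| ≤ b|x−y|₁. Then the lower deviation bound holds: μ({f < med_μ f − C_τ·t}) ≤ 2exp(−(1/8)min{t/b, t²/a²}) for all t ≥ 0. -/

import Mathlib

open MeasureTheory Set Real

noncomputable def hub (x : ℝ) : ℝ := if |x| ≤ 1 then x ^ 2 / 2 else |x| - 1 / 2

lemma hub_ge (s x : ℝ) (hs : |s| ≤ 1) : s * x - s ^ 2 / 2 ≤ hub x := by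
  unfold hub
  split_ifs with hx
  · nlinarith [sq_nonneg (s - x)]
  · push Not at hx
    have h1 : s * x ≤ |s| * |x| := by rw [← abs_mul]; exact le_abs_self _
    have h2 : s ^ 2 = |s| ^ 2 := (sq_abs s).symm
    have h3 := abs_nonneg s
    rw [h2]
    nlinarith [mul_nonneg (sub_nonneg.2 hs) (sub_nonneg.2 hx.le), sq_nonneg (|s| - 1)]

lemma hub_eq (x : ℝ) : ∃ s, |s| ≤ 1 ∧ hub x = s * x - s ^ 2 / 2 := by
  unfold hub
  split_ifs with hx
  · exact ⟨x, hx, by ring⟩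
  · push Not at hx
    rcases le_total 0 x with h | h
    · exact ⟨1, by simp, by rw [abs_of_nonneg h]; ring⟩
    · exact ⟨-1, by simp, by rw [abs_of_nonpos h]; ring⟩

lemma hub_neg (x : ℝ) : hub (-x) = hub x := by simp [hub]

lemma hub_nonneg (x : ℝ) : 0 ≤ hub x := by
  have := hub_ge 0 x (by simp)
  simpa using this

lemma hub_lin (x : ℝ) : |x| - 1 / 2 ≤ hub x := by
  rcases le_total 0 x with h | h
  · have := hub_ge 1 x (by simp)
    rw [abs_of_nonneg h]; linarith
  · have := hub_ge (-1) x (by simp)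
    rw [abs_of_nonpos h]; linarith

lemma hub_le (x : ℝ) : hub x ≤ x ^ 2 / 2 := by
  obtain ⟨s, -, h⟩ := hub_eq x
  rw [h]; nlinarith [sq_nonneg (s - x)]

lemma hub_zero : hub 0 = 0 := by simp [hub]

lemma hub_lip (x y : ℝ) : hub x ≤ hub y + |x - y| := by
  obtain ⟨s, hs, h⟩ := hub_eq x
  have h1 := hub_ge s y hs
  have h2 : s * (x - y) ≤ |x - y| := by
    calc s * (x - y) ≤ |s * (x - y)| := le_abs_self _
      _ = |s| * |x - y| := abs_mul _ _
      _ ≤ 1 * |x - y| := by gcongr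
      _ = _ := one_mul _
  rw [h]; linarith

lemma hub_mono {x y : ℝ} (hx : 0 ≤ x) (hxy : x ≤ y) : hub x ≤ hub y := by
  unfold hub
  rw [abs_of_nonneg hx, abs_of_nonneg (hx.trans hxy)]
  split_ifs <;> nlinarith [sq_nonneg (x-1)]

lemma hub_convex (x y a b : ℝ) (ha : 0 ≤ a) (hb : 0 ≤ b) (hab : a + b = 1) :
    hub (a * x + b * y) ≤ a * hub x + b * hub y := by
  obtain ⟨s, hs, h⟩ := hub_eq (a * x + b * y)
  have h1 := mul_le_mul_of_nonneg_left (hub_ge s x hs) ha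
  have h2 := mul_le_mul_of_nonneg_left (hub_ge s y hs) hb
  have h3 : s * (a * x + b * y) - s ^ 2 / 2 =
      a * (s * x - s ^ 2 / 2) + b * (s * y - s ^ 2 / 2) := by
    have : b = 1 - a := by linarith
    subst this; ring
  rw [h, h3]; linarith

lemma tail_shift (μ : Measure ℝ) [IsProbabilityMeasure μ] (h l : ℝ)
    (htail : ∀ x : ℝ, 0 ≤ x → μ (Set.Ici (x + h)) ≤ ENNReal.ofReal l * μ (Set.Ici x))
    (W : ℝ → ℝ) (hc : Continuous W) (hm : Monotone W) (h0 : ∀ x ≤ 0, W x = 0) :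
    ∫⁻ x, ENNReal.ofReal (W (x - h)) ∂μ ≤ ENNReal.ofReal l * ∫⁻ x, ENNReal.ofReal (W x) ∂μ := by
  have hnn : ∀ x, 0 ≤ W x := fun x => by
    rcases le_total x 0 with hx | hx
    · exact (h0 x hx).ge
    · rw [← h0 0 le_rfl]; exact hm hx
  rw [lintegral_eq_lintegral_meas_le μ (Filter.Eventually.of_forall fun x => hnn (x - h))
      (by fun_prop),
    lintegral_eq_lintegral_meas_le μ (Filter.Eventually.of_forall hnn) (by fun_prop),
    ← lintegral_const_mul' _ _ ENNReal.ofReal_ne_top]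
  refine setLIntegral_mono' measurableSet_Ioi fun t ht => ?_
  have ht : 0 < t := ht
  by_cases hne : {x | t ≤ W x}.Nonempty
  · have hcl : IsClosed {x | t ≤ W x} := isClosed_le continuous_const hc
    have hbd : ∀ x ∈ {x | t ≤ W x}, 0 ≤ x := fun x hx => by
      by_contra hcon
      have := h0 x (by linarith)
      have hx : t ≤ W x := hx
      linarith
    have hmem := hcl.csInf_mem hne ⟨0, hbd⟩
    set y := sInf {x | t ≤ W x}
    have hS : {x | t ≤ W x} = Ici y := by
      ext x
      exact ⟨fun hx => csInf_le ⟨0, hbd⟩ hx, fun hx => le_trans hmem (hm hx)⟩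
    have hS2 : {x | t ≤ W (x - h)} = Ici (y + h) := by
      ext x
      have : x - h ∈ {x | t ≤ W x} ↔ x - h ∈ Ici y := by rw [hS]
      simp only [mem_ofPred_eq, mem_Ici] at this ⊢
      rw [this]
      constructor <;> intro <;> linarith
    rw [hS, hS2]
    exact htail y (hbd y hmem)
  · have : {x | t ≤ W (x - h)} = ∅ := by
      ext x
      simp only [mem_ofPred_eq, mem_empty_iff_false, iff_false]
      intro hx
      exact hne ⟨x - h, hx⟩
    rw [this]; simp

lemma exp_int_pos (μ : Measure ℝ) [IsProbabilityMeasure μ] (h l : ℝ) (hh : 0 < h)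
    (hl0 : 0 ≤ l) (hl1 : l < 1)
    (htail : ∀ x : ℝ, 0 ≤ x → μ (Set.Ici (x + h)) ≤ ENNReal.ofReal l * μ (Set.Ici x))
    (C : ℝ) (hC : C = 17 * h / (1 - l) ^ 2) :
    Integrable (fun x => exp (max x 0 / C)) μ := by
  have hk : 0 < 1 - l := by linarith
  have hCpos : 0 < C := by rw [hC]; positivity
  have hd : h / C = (1 - l) ^ 2 / 17 := by rw [hC]; field_simp
  set d := h / C with hd'
  have hdpos : 0 < d := by positivity
  have he : exp d * l < 1 := by
    have h1 : exp d ≤ 1 / (1 - d) := by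
      apply Real.exp_bound_div_one_sub_of_interval hdpos.le
      rw [hd]; nlinarith
    have h2 : l < 1 - d := by rw [hd]; nlinarith
    calc exp d * l ≤ 1 / (1 - d) * l := by gcongr
      _ < 1 := by rw [one_div, inv_mul_lt_iff₀ (by linarith)]; linarith
  have he1 : 1 ≤ exp d := Real.one_le_exp hdpos.le
  let W : ℕ → ℝ → ℝ := fun N x => min (exp (max x 0 / C) - 1) N
  have hWnn : ∀ N x, 0 ≤ W N x := fun N x => by
    refine le_min ?_ (by positivity)
    have := Real.one_le_exp (show 0 ≤ max x 0 / C by positivity)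
    linarith
  have key : ∀ N, ∫ x, W N x ∂μ ≤ (exp d - 1) / (1 - exp d * l) := by
    intro N
    have hcont : Continuous (W N) := by fun_prop
    have hInt : ∀ g : ℝ → ℝ, Continuous g → Integrable (fun x => W N (g x)) μ := fun g hg => by
      refine Integrable.of_bound (C := (N : ℝ)) (by fun_prop) (Filter.Eventually.of_forall fun x => ?_)
      rw [Real.norm_of_nonneg (hWnn N _)]
      exact min_le_right _ _
    have hs := tail_shift μ h l htail (W N) hcont
      (fun x y hxy => by
        have : max x 0 ≤ max y 0 := max_le_max_right _ hxy
        simp only [W]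
        gcongr) (fun x hx => by simp [W, max_eq_right hx])
    rw [← ofReal_integral_eq_lintegral_ofReal (hInt _ (by fun_prop)) (Filter.Eventually.of_forall fun x => hWnn N _),
      ← ofReal_integral_eq_lintegral_ofReal (show Integrable (fun x => W N x) μ from hInt id (by fun_prop)) (Filter.Eventually.of_forall fun x => hWnn N _),
      ← ENNReal.ofReal_mul hl0, ENNReal.ofReal_le_ofReal_iff (mul_nonneg hl0 (integral_nonneg fun x => hWnn N _))] at hs
    have hpt : ∀ x, W N x ≤ exp d * W N (x - h) + (exp d - 1) := by
      intro x
      have hmul : exp (max x 0 / C) ≤ exp d * exp (max (x - h) 0 / C) := by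
        rw [← Real.exp_add]
        apply Real.exp_le_exp.2
        rw [hd', ← add_div]
        gcongr
        rcases le_total (x - h) 0 with h1 | h1
        · rw [max_eq_right h1]; apply max_le <;> linarith
        · rw [max_eq_left h1]; apply max_le <;> linarith
      simp only [W]
      rcases le_total (exp (max (x-h) 0 / C) - 1) (N:ℝ) with h1 | h1
      · rw [min_eq_left h1]
        refine (min_le_left _ _).trans ?_
        linarith
      · rw [min_eq_right h1]
        refine (min_le_right _ _).trans ?_
        nlinarith [Nat.cast_nonneg (α := ℝ) N]
    have hI : ∫ x, W N x ∂μ ≤ ∫ x, (exp d * W N (x - h) + (exp d - 1)) ∂μ :=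
      integral_mono (hInt id (by fun_prop)) (((hInt _ (by fun_prop)).const_mul _).add (integrable_const _)) hpt
    rw [integral_add ((hInt _ (by fun_prop)).const_mul _) (integrable_const _), integral_const_mul] at hI
    simp at hI
    rw [le_div_iff₀ (by linarith)]
    nlinarith [mul_le_mul_of_nonneg_left hs (by positivity : 0 ≤ exp d)]
  have hInt2 : Integrable (fun x => exp (max x 0 / C) - 1) μ := by
    refine ⟨by fun_prop, ?_⟩
    rw [hasFiniteIntegral_iff_ofReal (Filter.Eventually.of_forall fun x => by
      have := Real.one_le_exp (show 0 ≤ max x 0 / C by positivity)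
      simp only [Pi.zero_apply]; linarith)]
    have hlim : ∀ x, Filter.Tendsto (fun N : ℕ => ENNReal.ofReal (W N x)) Filter.atTop
        (nhds (ENNReal.ofReal (exp (max x 0 / C) - 1))) := fun x => by
      apply tendsto_const_nhds.congr'
      obtain ⟨M, hM⟩ := exists_nat_ge (exp (max x 0 / C) - 1)
      filter_upwards [Filter.eventually_ge_atTop M] with N hN
      simp only [W]
      rw [min_eq_left (hM.trans (by exact_mod_cast hN))]
    have hmono : ∀ x, Monotone fun N : ℕ => ENNReal.ofReal (W N x) := fun x N M hNM => by
      apply ENNReal.ofReal_le_ofReal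
      simp only [W]; gcongr
    have ht := lintegral_tendsto_of_tendsto_of_monotone (μ := μ) (f := fun N x => ENNReal.ofReal (W N x))
      (fun N => by have : Continuous (W N) := by fun_prop
                   fun_prop)
      (Filter.Eventually.of_forall hmono) (Filter.Eventually.of_forall hlim)
    refine lt_of_le_of_lt (le_of_tendsto' ht fun N => ?_) (ENNReal.ofReal_lt_top (r := (exp d - 1) / (1 - exp d * l)))
    rw [← ofReal_integral_eq_lintegral_ofReal _ (Filter.Eventually.of_forall fun x => hWnn N _)]
    · exact ENNReal.ofReal_le_ofReal (key N)
    · refine Integrable.of_bound (C := (N : ℝ)) ?_ (Filter.Eventually.of_forall fun x => ?_)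
      · have : Continuous (W N) := by fun_prop
        fun_prop
      rw [Real.norm_of_nonneg (hWnn N _)]
      exact min_le_right _ _
  refine (hInt2.add (integrable_const (1:ℝ))).congr (Filter.Eventually.of_forall fun x => ?_)
  simp

lemma exp_int_abs (μ : Measure ℝ) [IsProbabilityMeasure μ] (h l : ℝ) (hh : 0 < h)
    (hl0 : 0 ≤ l) (hl1 : l < 1) (hsym : μ.map (fun x => -x) = μ)
    (htail : ∀ x : ℝ, 0 ≤ x → μ (Set.Ici (x + h)) ≤ ENNReal.ofReal l * μ (Set.Ici x))
    (C : ℝ) (hC : C = 17 * h / (1 - l) ^ 2) :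
    Integrable (fun x => exp (|x| / C)) μ := by
  have h1 := exp_int_pos μ h l hh hl0 hl1 htail C hC
  have hmp : MeasurePreserving (fun x : ℝ => -x) μ μ := ⟨measurable_neg, hsym⟩
  have h2 := hmp.integrable_comp_of_integrable h1
  refine (h1.add h2).mono' (by fun_prop) (Filter.Eventually.of_forall fun x => ?_)
  rw [Real.norm_of_nonneg (exp_pos _).le]
  simp only [Pi.add_apply, Function.comp]
  rcases le_total 0 x with hx | hx
  · rw [abs_of_nonneg hx, max_eq_left hx]; linarith [exp_pos (max (-x) 0 / C)]
  · rw [abs_of_nonpos hx, max_eq_left (by linarith : 0 ≤ -x)]; linarith [exp_pos (max (x) 0 / C)]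

lemma cvx2 {f : ℝ → ℝ} (hf : ConvexOn ℝ univ f) (x y a b : ℝ) (ha : 0 ≤ a) (hb : 0 ≤ b)
    (hab : a + b = 1) : f (a * x + b * y) ≤ a * f x + b * f y := by
  have := hf.2 (mem_univ x) (mem_univ y) ha hb hab
  simpa only [smul_eq_mul] using this

set_option maxHeartbeats 1000000 in
lemma one_side (μ : Measure ℝ) [IsProbabilityMeasure μ] (h l : ℝ) (hh : 0 < h)
    (hl0 : 0 ≤ l) (hl1 : l < 1)
    (htail : ∀ x : ℝ, 0 ≤ x → μ (Set.Ici (x + h)) ≤ ENNReal.ofReal l * μ (Set.Ici x))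
    (C : ℝ) (hC : C = 17 * h / (1 - l) ^ 2)
    (hI : Integrable (fun x => exp (|x| / C)) μ)
    (p : ℝ → ℝ) (hpc : Continuous p) (hpm : Monotone p) (hp0 : ∀ x ≤ 0, p x = 0)
    (hlip : ∀ x y, |p x - p y| ≤ |x - y| / C) :
    Integrable (fun x => exp (p x - (C / h - 1 / 2) * (p x - p (x - h)) ^ 2) + exp (p x)
      + 2 * exp (- p x) - 4) μ ∧
    ∫ x, (exp (p x - (C / h - 1 / 2) * (p x - p (x - h)) ^ 2) + exp (p x)
      + 2 * exp (- p x) - 4) ∂μ ≤ 0 := by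
  have hk : 0 < 1 - l := by linarith
  have hCpos : 0 < C := by rw [hC]; positivity
  have hCh : C / h = 17 / (1 - l) ^ 2 := by rw [hC]; field_simp
  have hk1 : (1 - l) ^ 2 ≤ 1 := by nlinarith
  have hk2 : 1 ≤ 1 / (1 - l) ^ 2 := by rw [le_div_iff₀ (by positivity)]; linarith
  set γ := C / h - 1 / 2 with hγ
  have hγ1 : 33 / 2 * (1 / (1 - l) ^ 2) ≤ γ := by
    rw [hγ, hCh]
    have : 17 / (1 - l) ^ 2 = 17 * (1 / (1 - l) ^ 2) := by ring
    rw [this]; linarith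
  have hγ0 : 0 ≤ γ := by linarith
  have hpn : ∀ x, 0 ≤ p x := fun x => by
    rcases le_total x 0 with hx | hx
    · exact (hp0 x hx).ge
    · rw [← hp0 0 le_rfl]; exact hpm hx
  have hpx : ∀ x, p x ≤ |x| / C := fun x => by
    have := hlip x 0
    rw [hp0 0 le_rfl, sub_zero, sub_zero] at this
    exact (le_abs_self _).trans this
  let D : ℝ → ℝ := fun x => p x - p (x - h)
  have hD0 : ∀ x, 0 ≤ D x := fun x => sub_nonneg.2 (hpm (by linarith))
  have hD1 : ∀ x, D x ≤ h / C := fun x => by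
    have := (le_abs_self _).trans (hlip x (x - h))
    rwa [sub_sub_cancel, abs_of_pos hh] at this
  have hhC : h / C = (1 - l) ^ 2 / 17 := by rw [hC]; field_simp
  have hgD : ∀ x, γ * D x ^ 2 ≤ 1 / 17 := fun x => by
    have h1 : D x ^ 2 ≤ (h / C) ^ 2 := pow_le_pow_left₀ (hD0 x) (hD1 x) 2
    calc γ * D x ^ 2 ≤ (C / h) * (h / C) ^ 2 := by
          gcongr
          rw [hγ]; linarith
      _ = h / C := by field_simp
      _ ≤ 1 / 17 := by rw [hhC]; linarith
  have hDc : Continuous D := by fun_prop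
  have hIp : Integrable (fun x => exp (p x)) μ :=
    hI.mono' (by fun_prop) (Filter.Eventually.of_forall fun x => by
      rw [Real.norm_of_nonneg (exp_pos _).le]; exact exp_le_exp.2 (hpx x))
  have hIm : Integrable (fun x => exp (- p x)) μ :=
    hIp.mono' (by fun_prop) (Filter.Eventually.of_forall fun x => by
      rw [Real.norm_of_nonneg (exp_pos _).le]; exact exp_le_exp.2 (by linarith [hpn x]))
  have hIg : Integrable (fun x => exp (p x - γ * (p x - p (x - h)) ^ 2)) μ :=
    hIp.mono' (by fun_prop) (Filter.Eventually.of_forall fun x => by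
      rw [Real.norm_of_nonneg (exp_pos _).le]; exact exp_le_exp.2 (by
        have : 0 ≤ γ * (p x - p (x - h)) ^ 2 := by positivity
        linarith))
  have hIT : Integrable (fun x => exp (p x - γ * (p x - p (x - h)) ^ 2) + exp (p x)
      + 2 * exp (- p x) - 4) μ :=
    ((hIg.add hIp).add (hIm.const_mul 2)).sub (integrable_const _)
  refine ⟨hIT, ?_⟩
  let W : ℝ → ℝ := fun x => exp (p x / 2) - exp (- (p x / 2))
  have hWn : ∀ x, 0 ≤ W x := fun x => by
    have : exp (- (p x / 2)) ≤ exp (p x / 2) := exp_le_exp.2 (by linarith [hpn x])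
    exact sub_nonneg.2 this
  have hWm : Monotone W := fun x y hxy => by
    have := hpm hxy
    have h1 : exp (p x / 2) ≤ exp (p y / 2) := exp_le_exp.2 (by linarith)
    have h2 : exp (- (p y / 2)) ≤ exp (- (p x / 2)) := exp_le_exp.2 (by linarith)
    simp only [W]; linarith
  have hWc : Continuous W := by fun_prop
  have hW2 : ∀ x, W x ^ 2 = exp (p x) + exp (- p x) - 2 := fun x => by
    have e1 : exp (p x) = exp (p x / 2) ^ 2 := by rw [← Real.exp_nat_mul]; congr 1; push_cast; ring
    have e2 : exp (- p x) = exp (- (p x / 2)) ^ 2 := by rw [← Real.exp_nat_mul]; congr 1; push_cast; ring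
    have e3 : exp (p x / 2) * exp (- (p x / 2)) = 1 := by rw [← Real.exp_add]; simp
    rw [e1, e2]; simp only [W]; nlinarith
  have hIW : Integrable (fun x => W x ^ 2) μ :=
    ((hIp.add hIm).sub (integrable_const 2)).congr (Filter.Eventually.of_forall fun x => by
      simp [hW2])
  have hIWh : Integrable (fun x => W (x - h) ^ 2) μ :=
    hIW.mono' (by fun_prop) (Filter.Eventually.of_forall fun x => by
      rw [Real.norm_of_nonneg (by positivity)]
      exact pow_le_pow_left₀ (hWn _) (hWm (by linarith)) 2)
  have hIJ : Integrable (fun x => exp (p x) * D x ^ 2) μ :=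
    (hIp.mul_const ((h / C) ^ 2)).mono' (by fun_prop) (Filter.Eventually.of_forall fun x => by
      rw [Real.norm_of_nonneg (by positivity)]
      have h1 : D x ^ 2 ≤ (h / C) ^ 2 := pow_le_pow_left₀ (hD0 x) (hD1 x) 2
      gcongr)
  have hs := tail_shift μ h l htail (fun x => W x ^ 2) (by fun_prop)
    (fun x y hxy => pow_le_pow_left₀ (hWn _) (hWm hxy) 2) (fun x hx => by simp [W, hp0 x hx])
  rw [← ofReal_integral_eq_lintegral_ofReal hIWh (Filter.Eventually.of_forall fun x => sq_nonneg _),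
      ← ofReal_integral_eq_lintegral_ofReal hIW (Filter.Eventually.of_forall fun x => sq_nonneg _),
      ← ENNReal.ofReal_mul hl0,
      ENNReal.ofReal_le_ofReal_iff (mul_nonneg hl0 (integral_nonneg fun x => sq_nonneg _))] at hs
  have hWD : ∀ x, W x - W (x - h) ≤ exp (p x / 2) * D x := fun x => by
    have hp1 : p (x - h) ≤ p x := hpm (by linarith)
    have e1 : exp (p x / 2) - exp (p (x - h) / 2) ≤ exp (p x / 2) * (D x / 2) := by
      have : exp (p (x - h) / 2) = exp (p x / 2) * exp (- (D x / 2)) := by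
        rw [← Real.exp_add]; congr 1; simp only [D]; ring
      rw [this]
      nlinarith [Real.add_one_le_exp (- (D x / 2)), exp_pos (p x / 2)]
    have e2 : exp (- (p (x - h) / 2)) - exp (- (p x / 2)) ≤ exp (p x / 2) * (D x / 2) := by
      have : exp (- (p x / 2)) = exp (- (p (x - h) / 2)) * exp (- (D x / 2)) := by
        rw [← Real.exp_add]; congr 1; simp only [D]; ring
      have h1 : exp (- (p (x - h) / 2)) ≤ exp (p x / 2) := exp_le_exp.2 (by linarith [hpn x, hpn (x - h)])
      have h2 : exp (- (p (x - h) / 2)) * (D x / 2) ≤ exp (p x / 2) * (D x / 2) := by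
        have := hD0 x
        gcongr
      rw [this]
      nlinarith [Real.add_one_le_exp (- (D x / 2)), exp_pos (- (p (x - h) / 2))]
    simp only [W] at *; linarith
  have hpt : ∀ x, W x ^ 2 - W (x - h) ^ 2 ≤
      (1 - l) / 2 * W x ^ 2 + 2 / (1 - l) * (exp (p x) * D x ^ 2) := fun x => by
    have e1 : exp (p x) = exp (p x / 2) ^ 2 := by rw [← Real.exp_nat_mul]; congr 1; push_cast; ring
    have h1 : W x ^ 2 - W (x - h) ^ 2 ≤ 2 * W x * (exp (p x / 2) * D x) := by
      have a1 := hWD x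
      have a2 := hWn x
      have a3 := hWn (x - h)
      have a4 : W (x - h) ≤ W x := hWm (by linarith)
      nlinarith [mul_le_mul_of_nonneg_left a1 (by positivity : 0 ≤ W x)]
    rw [e1, ← mul_pow]
    set Z := exp (p x / 2) * D x
    have h2 : 2 / (1 - l) * Z ^ 2 = 2 / (1 - l) * Z ^ 2 := rfl
    have h3 : 0 ≤ (1 - l) / 2 * (W x - 2 / (1 - l) * Z) ^ 2 := by positivity
    have h4 : (1 - l) / 2 * (W x - 2 / (1 - l) * Z) ^ 2 =
      (1 - l) / 2 * W x ^ 2 + 2 / (1 - l) * Z ^ 2 - 2 * W x * Z := by field_simp; ring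
    linarith
  have hInt := integral_mono (hIW.sub hIWh) ((hIW.const_mul ((1 - l) / 2)).add (hIJ.const_mul (2 / (1 - l)))) hpt
  simp only [Pi.sub_apply, Pi.add_apply] at hInt
  rw [integral_sub hIW hIWh, integral_add (hIW.const_mul _) (hIJ.const_mul _), integral_const_mul,
    integral_const_mul] at hInt
  have hpt2 : ∀ x, exp (p x - γ * (p x - p (x - h)) ^ 2) + exp (p x) + 2 * exp (- p x) - 4 ≤
      2 * W x ^ 2 - 16 / (1 - l) ^ 2 * (exp (p x) * D x ^ 2) := fun x => by
    have hg0 : 0 ≤ γ * D x ^ 2 := by positivity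
    have hg1 := hgD x
    have h1 : exp (- (γ * D x ^ 2)) ≤ 1 - 33 / 34 * (γ * D x ^ 2) := by
      have hb := Real.add_one_le_exp (γ * D x ^ 2)
      set g := γ * D x ^ 2
      have hb2 := Real.quadratic_le_exp_of_nonneg hg0
      rw [Real.exp_neg, inv_le_iff_one_le_mul₀ (exp_pos _)]
      have : 0 ≤ 1 - 33 / 34 * g := by linarith
      nlinarith [mul_le_mul_of_nonneg_left hb2 this, mul_nonneg hg0 hg0, mul_nonneg hg0 (sub_nonneg.2 hg1)]
    have h2 : 16 / (1 - l) ^ 2 * D x ^ 2 ≤ 33 / 34 * (γ * D x ^ 2) := by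
      have : 16 / (1 - l) ^ 2 ≤ 33 / 34 * γ := by
        have : 16 / (1 - l) ^ 2 = 16 * (1 / (1 - l) ^ 2) := by ring
        rw [this]; linarith
      nlinarith [mul_le_mul_of_nonneg_right this (sq_nonneg (D x))]
    have h3 : exp (p x - γ * (p x - p (x - h)) ^ 2) = exp (p x) * exp (- (γ * D x ^ 2)) := by
      rw [← Real.exp_add]; congr 1
    rw [h3, hW2]
    nlinarith [mul_le_mul_of_nonneg_left (h1.trans (sub_le_sub_left h2 1)) (exp_pos (p x)).le]
  have hInt2 := integral_mono hIT ((hIW.const_mul 2).sub (hIJ.const_mul (16 / (1 - l) ^ 2))) hpt2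
  simp only [Pi.sub_apply] at hInt2
  rw [integral_sub (hIW.const_mul _) (hIJ.const_mul _), integral_const_mul, integral_const_mul] at hInt2
  have hJ : 0 ≤ ∫ x, exp (p x) * D x ^ 2 ∂μ := integral_nonneg fun x => by positivity
  set I := ∫ x, W x ^ 2 ∂μ
  set J := ∫ x, exp (p x) * D x ^ 2 ∂μ
  refine hInt2.trans ?_
  have h5 : (1 - l) / 2 * I ≤ 2 / (1 - l) * J := by nlinarith
  have h6 : I ≤ 4 / (1 - l) ^ 2 * J := by
    have : I = 2 / (1 - l) * ((1 - l) / 2 * I) := by field_simp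
    rw [this]
    calc _ ≤ 2 / (1 - l) * (2 / (1 - l) * J) := by gcongr
      _ = _ := by field_simp; ring
  have h7 : 0 ≤ 1 / (1 - l) ^ 2 * J := by positivity
  have h8 : 4 / (1 - l) ^ 2 * J = 4 * (1 / (1 - l) ^ 2 * J) := by ring
  have h9 : 16 / (1 - l) ^ 2 * J = 16 * (1 / (1 - l) ^ 2 * J) := by ring
  linarith

lemma trunc_props (C : ℝ) (hC : 0 < C) (h : ℝ) (hh : 0 < h) (k : ℝ → ℝ) (hk : ConvexOn ℝ univ k)
    (hk0 : k 0 = 0) (hkn : ∀ x, 0 ≤ k x) (hlip : ∀ x y, |k x - k y| ≤ |x - y| / C) :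
    Continuous (fun x => k (max x 0)) ∧ Monotone (fun x => k (max x 0)) ∧
    (∀ x ≤ 0, k (max x 0) = 0) ∧
    (∀ x y, |k (max x 0) - k (max y 0)| ≤ |x - y| / C) ∧
    (∀ x q, 0 ≤ x → (∀ y, 0 ≤ y → q ≤ k y + hub ((x - y) / C)) →
      q ≤ k (max x 0) - (C / h - 1 / 2) * (k (max x 0) - k (max (x - h) 0)) ^ 2) := by
  have hmono : ∀ x y, 0 ≤ x → x ≤ y → k x ≤ k y := fun x y hx hxy => by
    rcases eq_or_lt_of_le (hx.trans hxy) with hy | hy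
    · have : x = y := by linarith
      rw [this]
    · have := cvx2 hk y 0 (x / y) (1 - x / y) (by positivity)
        (by rw [sub_nonneg, div_le_one hy]; exact hxy) (by ring)
      simp only [mul_zero, add_zero, hk0] at this
      rw [div_mul_cancel₀ _ hy.ne'] at this
      have h2 : x / y * k y ≤ 1 * k y := by
        have := hkn y
        have : x / y ≤ 1 := by rw [div_le_one hy]; exact hxy
        gcongr
      linarith
  have hl2 : ∀ x y, |k (max x 0) - k (max y 0)| ≤ |x - y| / C := fun x y => by
    refine (hlip _ _).trans ?_
    have := abs_max_sub_max_le_abs x y 0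
    exact div_le_div_of_nonneg_right this hC.le
  have hm2 : Monotone (fun x => k (max x 0)) := fun x y hxy =>
    hmono _ _ (le_max_right _ _) (max_le_max_right _ hxy)
  refine ⟨?_, hm2, fun x hx => by rw [max_eq_right hx, hk0], hl2, ?_⟩
  · refine (LipschitzWith.of_dist_le_mul (K := ⟨1 / C, by positivity⟩) fun x y => ?_).continuous
    rw [Real.dist_eq, Real.dist_eq]
    refine (hl2 x y).trans_eq ?_
    show _ = (1 / C) * |x - y|
    ring
  · intro x q hx hq
    have hDn : 0 ≤ k (max x 0) - k (max (x - h) 0) := sub_nonneg.2 (hm2 (by linarith))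
    have hD1 : k (max x 0) - k (max (x - h) 0) ≤ h / C := by
      have := (le_abs_self _).trans (hl2 x (x - h))
      simpa [abs_of_pos hh] using this
    have hxe : max (x - h) 0 = x - min h x := by
      rcases le_total h x with h1 | h1
      · rw [min_eq_left h1, max_eq_left (by linarith)]
      · rw [min_eq_right h1, max_eq_right (by linarith)]; ring
    set D := k (max x 0) - k (max (x - h) 0) with hD
    rw [max_eq_left hx] at hD ⊢
    rw [hxe] at hD
    set e := min h x
    have he0 : 0 ≤ e := le_min hh.le hx
    have heh : e ≤ h := min_le_left _ _
    have hex : e ≤ x := min_le_right _ _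
    set θ := D * (C / h) with hθ
    have hθ0 : 0 ≤ θ := by positivity
    have hθ1 : θ ≤ 1 := by
      calc θ ≤ h / C * (C / h) := by rw [hθ]; gcongr
        _ = 1 := by field_simp
    have h1 := hq (x - θ * e) (by nlinarith)
    have h2 := cvx2 hk x (x - e) (1 - θ) θ (by linarith) hθ0 (by ring)
    have h3 : (1 - θ) * x + θ * (x - e) = x - θ * e := by ring
    rw [h3] at h2
    have h4 : hub ((x - (x - θ * e)) / C) ≤ D ^ 2 / 2 := by
      refine (hub_le _).trans ?_
      have : (x - (x - θ * e)) / C = D * (e / h) := by rw [hθ]; field_simp; ring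
      rw [this]
      have h5 : D * (e / h) ≤ D * 1 := by
        gcongr
        rw [div_le_one hh]; exact heh
      have h6 : 0 ≤ D * (e / h) := by positivity
      nlinarith
    have h7 : θ * D = C / h * D ^ 2 := by rw [hθ]; ring
    nlinarith

lemma lip_cont (C : ℝ) (hC : 0 < C) (f : ℝ → ℝ) (hlip : ∀ x y, |f x - f y| ≤ |x - y| / C) :
    Continuous f := by
  refine (LipschitzWith.of_dist_le_mul (K := ⟨1 / C, by positivity⟩) fun x y => ?_).continuous
  rw [Real.dist_eq, Real.dist_eq]
  refine (hlip x y).trans_eq ?_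
  show _ = (1 / C) * |x - y|
  ring

lemma one_dim_aux (μ : Measure ℝ) [IsProbabilityMeasure μ] (h l : ℝ) (hh : 0 < h)
    (hl0 : 0 ≤ l) (hl1 : l < 1) (hsym : μ.map (fun x => -x) = μ)
    (htail : ∀ x : ℝ, 0 ≤ x → μ (Set.Ici (x + h)) ≤ ENNReal.ofReal l * μ (Set.Ici x))
    (C : ℝ) (hC : C = 17 * h / (1 - l) ^ 2)
    (f q : ℝ → ℝ) (hf : ConvexOn ℝ univ f) (hlip : ∀ x y, |f x - f y| ≤ |x - y| / C)
    (hqm : Measurable q) (hq : ∀ x y, q x ≤ f y + hub ((x - y) / C))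
    (hf0 : f 0 = 0) (hfpos : ∀ x, 0 ≤ x → 0 ≤ f x) :
    Integrable (fun x => exp (q x)) μ ∧ Integrable (fun x => exp (- f x)) μ ∧
    ∫ x, exp (q x) ∂μ + ∫ x, exp (- f x) ∂μ ≤ 2 := by
  have hk : 0 < 1 - l := by linarith
  have hCpos : 0 < C := by rw [hC]; positivity
  have hI := exp_int_abs μ h l hh hl0 hl1 hsym htail C hC
  have hfc := lip_cont C hCpos f hlip
  have hqf : ∀ x, q x ≤ f x := fun x => by simpa [hub_zero] using hq x x
  have hfx : ∀ x, |f x| ≤ |x| / C := fun x => by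
    have := hlip x 0
    simpa [hf0] using this
  have hIq : Integrable (fun x => exp (q x)) μ :=
    hI.mono' (by fun_prop) (Filter.Eventually.of_forall fun x => by
      rw [Real.norm_of_nonneg (exp_pos _).le]
      exact exp_le_exp.2 ((hqf x).trans ((le_abs_self _).trans (hfx x))))
  have hIf : Integrable (fun x => exp (- f x)) μ :=
    hI.mono' (by fun_prop) (Filter.Eventually.of_forall fun x => by
      rw [Real.norm_of_nonneg (exp_pos _).le]
      exact exp_le_exp.2 ((neg_le_abs _).trans (hfx x)))
  refine ⟨hIq, hIf, ?_⟩
  have hmaxlip : ∀ u v : ℝ, |max u 0 - max v 0| ≤ |u - v| := fun u v => by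
    simpa using abs_max_sub_max_le_abs u v 0
  have hfneg : ConvexOn ℝ univ (fun x => f (-x)) := by
    refine ⟨convex_univ, fun x _ y _ a b ha hb hab => ?_⟩
    have := hf.2 (mem_univ (-x)) (mem_univ (-y)) ha hb hab
    simp only [smul_eq_mul] at this ⊢
    convert this using 2; ring
  obtain ⟨c1, m1, z1, l1, k1⟩ := trunc_props C hCpos h hh (fun x => max (f x) 0)
    (hf.sup (convexOn_const 0 convex_univ)) (by simp [hf0]) (fun x => le_max_right _ _)
    (fun x y => (hmaxlip _ _).trans (hlip x y))
  obtain ⟨c2, m2, z2, l2, k2⟩ := trunc_props C hCpos h hh (fun x => max (f (-x)) 0)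
    (hfneg.sup (convexOn_const 0 convex_univ)) (by simp [hf0]) (fun x => le_max_right _ _)
    (fun x y => (hmaxlip _ _).trans ((hlip _ _).trans_eq (by
      congr 1; rw [← abs_neg]; congr 1; ring)))
  obtain ⟨i1, b1⟩ := one_side μ h l hh hl0 hl1 htail C hC hI _ c1 m1 z1 l1
  obtain ⟨i2, b2⟩ := one_side μ h l hh hl0 hl1 htail C hC hI _ c2 m2 z2 l2
  have n1 : ∀ x, 0 ≤ max (f (max x 0)) 0 := fun x => le_max_right _ _
  have n2 : ∀ x, 0 ≤ max (f (-(max x 0))) 0 := fun x => le_max_right _ _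
  obtain ⟨p1, e1⟩ : ∃ p : ℝ → ℝ, ∀ x, p x = max (f (max x 0)) 0 := ⟨_, fun _ => rfl⟩
  obtain ⟨p2, e2⟩ : ∃ p : ℝ → ℝ, ∀ x, p x = max (f (-(max x 0))) 0 := ⟨_, fun _ => rfl⟩
  simp only [← e1] at c1 m1 z1 l1 k1 i1 b1 n1
  simp only [← e2] at c2 m2 z2 l2 k2 i2 b2 n2
  set G : ℝ → ℝ := fun x => exp (q x) + exp (- f x) - 2 with hG
  have hIG : Integrable G μ := (hIq.add hIf).sub (integrable_const _)
  have hGi : ∫ x, G x ∂μ = ∫ x, exp (q x) ∂μ + ∫ x, exp (- f x) ∂μ - 2 := by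
    have : ∫ x, G x ∂μ = ∫ x, (exp (q x) + exp (- f x)) ∂μ - ∫ x, (2 : ℝ) ∂μ :=
      integral_sub (hIq.add hIf) (integrable_const _)
    rw [this, integral_add hIq hIf]; simp
  have hmp : MeasurePreserving (fun x : ℝ => -x) μ μ := ⟨measurable_neg, hsym⟩
  have hneg : ∫ x, (Iio (0:ℝ)).indicator G x ∂μ = ∫ x, (Iio (0:ℝ)).indicator G (-x) ∂μ :=
    (hmp.integral_comp (Homeomorph.neg ℝ).measurableEmbedding _).symm
  have hIn1 : Integrable ((Iio (0:ℝ)).indicator G) μ := hIG.indicator measurableSet_Iio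
  have hIn2 : Integrable (fun x => (Iio (0:ℝ)).indicator G (-x)) μ := hmp.integrable_comp_of_integrable hIn1
  have hIn3 : Integrable ((Ici (0:ℝ)).indicator G) μ := hIG.indicator measurableSet_Ici
  have hsplit : ∫ x, G x ∂μ = ∫ x, ((Ici (0:ℝ)).indicator G x + (Iio (0:ℝ)).indicator G (-x)) ∂μ := by
    rw [integral_add hIn3 hIn2, ← hneg, ← integral_add hIn3 hIn1]
    congr 1; ext x
    rcases le_or_gt 0 x with hx | hx
    · simp [indicator, hx]
    · simp [indicator, hx]
  have htwo : ∀ u : ℝ, 2 ≤ exp u + exp (-u) := fun u => by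
    have := Real.one_le_cosh u
    rw [Real.cosh_eq] at this; linarith
  have hle : ∫ x, ((Ici (0:ℝ)).indicator G x + (Iio (0:ℝ)).indicator G (-x)) ∂μ ≤ 
     ∫ x, ((exp (p1 x - (C / h - 1 / 2) * (p1 x - p1 (x - h)) ^ 2) + exp (p1 x)
      + 2 * exp (- p1 x) - 4) + (exp (p2 x - (C / h - 1 / 2) * (p2 x - p2 (x - h)) ^ 2) + exp (p2 x)
      + 2 * exp (- p2 x) - 4)) ∂μ := by
    refine integral_mono (hIn3.add hIn2) (i1.add i2) fun x => ?_
    simp only [Pi.add_apply]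
    rcases lt_or_ge x 0 with hx | hx
    · rw [indicator_of_notMem (by simpa using hx), indicator_of_notMem (by simp; linarith),
        z1 x hx.le, z2 x hx.le, z1 (x - h) (by linarith), z2 (x - h) (by linarith)]
      norm_num
    have hA1 : G x ≤ exp (p1 x - (C / h - 1 / 2) * (p1 x - p1 (x - h)) ^ 2) + exp (- p1 x) - 2 := by
      have hp1x : p1 x = f x := by rw [e1, max_eq_left hx, max_eq_left (hfpos x hx)]
      have := k1 x (q x) hx (fun y hy => (hq x y).trans (by gcongr; exact le_max_left _ _))
      have := exp_le_exp.2 this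
      simp only [hG]
      have h3 : exp (-p1 x) = exp (-f x) := by rw [hp1x]
      linarith
    have hA2 : G (-x) ≤ (exp (p2 x - (C / h - 1 / 2) * (p2 x - p2 (x - h)) ^ 2) + exp (- p2 x) - 2)
        + (exp (p1 x) + exp (- p1 x) - 2) := by
      have hp1x : p1 x = f x := by rw [e1, max_eq_left hx, max_eq_left (hfpos x hx)]
      rcases le_total (f (-x)) 0 with hfx0 | hfx0
      · have hp2x : p2 x = 0 := by rw [e2, max_eq_left hx, max_eq_right hfx0]
        have hp2h : p2 (x - h) = 0 := le_antisymm (by rw [← hp2x]; exact m2 (by linarith)) (n2 _)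
        rw [hp2x, hp2h, hp1x]
        have hmid : 0 ≤ f x + f (-x) := by
          have := cvx2 hf x (-x) (1/2) (1/2) (by norm_num) (by norm_num) (by norm_num)
          rw [show (1/2 : ℝ) * x + 1/2 * (-x) = 0 by ring, hf0] at this
          linarith
        have hcosh : Real.cosh (f (-x)) ≤ Real.cosh (f x) := by
          rw [Real.cosh_le_cosh, abs_of_nonpos hfx0, abs_of_nonneg (hfpos x hx)]; linarith
        rw [Real.cosh_eq, Real.cosh_eq] at hcosh
        have hqe := exp_le_exp.2 (hqf (-x))
        simp only [hG]
        norm_num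
        linarith
      · have hp2x : p2 x = f (-x) := by rw [e2, max_eq_left hx, max_eq_left hfx0]
        have := k2 x (q (-x)) hx (fun y hy => (hq (-x) (-y)).trans (by
          rw [show (-x - -y) / C = -((x - y) / C) by ring, hub_neg]
          gcongr; exact le_max_left _ _))
        have := exp_le_exp.2 this
        simp only [hG]
        have h3 : exp (-p2 x) = exp (-f (-x)) := by rw [hp2x]
        have := htwo (p1 x)
        linarith
    have ht2 := htwo (p2 x)
    have ht1 := htwo (p1 x)
    rw [indicator_of_mem (by simpa using hx)]
    rcases eq_or_lt_of_le hx with hx0 | hx0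
    · rw [indicator_of_notMem (by simp [← hx0])]
      rw [z1 x hx0.ge, z1 (x-h) (by linarith)] at hA1
      rw [z1 x hx0.ge, z2 x hx0.ge, z1 (x-h) (by linarith), z2 (x-h) (by linarith)] 
      norm_num at hA1 ⊢
      linarith
    · rw [indicator_of_mem (by simpa using hx0)]
      linarith
  rw [integral_add i1 i2] at hle
  linarith

lemma one_dim (μ : Measure ℝ) [IsProbabilityMeasure μ] (h l : ℝ) (hh : 0 < h)
    (hl0 : 0 ≤ l) (hl1 : l < 1) (hsym : μ.map (fun x => -x) = μ)
    (htail : ∀ x : ℝ, 0 ≤ x → μ (Set.Ici (x + h)) ≤ ENNReal.ofReal l * μ (Set.Ici x))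
    (C : ℝ) (hC : C = 17 * h / (1 - l) ^ 2)
    (f q : ℝ → ℝ) (hf : ConvexOn ℝ univ f) (hlip : ∀ x y, |f x - f y| ≤ |x - y| / C)
    (hqm : Measurable q) (hq : ∀ x y, q x ≤ f y + hub ((x - y) / C)) :
    Integrable (fun x => exp (q x)) μ ∧ Integrable (fun x => exp (- f x)) μ ∧
    (∫ x, exp (q x) ∂μ) * ∫ x, exp (- f x) ∂μ ≤ 1 := by
  have key : ∀ f q : ℝ → ℝ, ConvexOn ℝ univ f → (∀ x y, |f x - f y| ≤ |x - y| / C) →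
      Measurable q → (∀ x y, q x ≤ f y + hub ((x - y) / C)) → f 0 = 0 →
      Integrable (fun x => exp (q x)) μ ∧ Integrable (fun x => exp (- f x)) μ ∧
      ∫ x, exp (q x) ∂μ + ∫ x, exp (- f x) ∂μ ≤ 2 := by
    intro f q hf hlip hqm hq hf0
    by_cases hpos : ∀ x, 0 ≤ x → 0 ≤ f x
    · exact one_dim_aux μ h l hh hl0 hl1 hsym htail C hC f q hf hlip hqm hq hf0 hpos
    · push Not at hpos
      obtain ⟨u, hu, hfu⟩ := hpos
      have hfneg : ConvexOn ℝ univ (fun x => f (-x)) := by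
        refine ⟨convex_univ, fun x _ y _ a b ha hb hab => ?_⟩
        have := hf.2 (mem_univ (-x)) (mem_univ (-y)) ha hb hab
        simp only [smul_eq_mul] at this ⊢
        convert this using 2; ring
      have hu' : 0 < u := lt_of_le_of_ne hu (by rintro rfl; linarith)
      have hmp : MeasurePreserving (fun x : ℝ => -x) μ μ := ⟨measurable_neg, hsym⟩
      obtain ⟨a1, a2, a3⟩ := one_dim_aux μ h l hh hl0 hl1 hsym htail C hC (fun x => f (-x)) (fun x => q (-x))
        hfneg (fun x y => (hlip _ _).trans_eq (by congr 1; rw [← abs_neg]; congr 1; ring))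
        (by fun_prop) (fun x y => (hq _ _).trans_eq (by
          rw [show (-x - -y) / C = -((x - y) / C) by ring, hub_neg])) (by simpa using hf0)
        (fun x hx => by
          by_contra hcon
          push Not at hcon
          have := cvx2 hf (-x) u (u / (u + x)) (x / (u + x))
            (by positivity) (by positivity) (by field_simp)
          rw [show u / (u + x) * (-x) + x / (u + x) * u = 0 by field_simp; ring, hf0] at this
          have h1 : u / (u + x) * f (-x) < 0 := mul_neg_of_pos_of_neg (by positivity) hcon
          have h2 : x / (u + x) * f u ≤ 0 := mul_nonpos_of_nonneg_of_nonpos (by positivity) hfu.le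
          linarith)
      have b1 := hmp.integrable_comp_of_integrable a1
      have b2 := hmp.integrable_comp_of_integrable a2
      simp only [Function.comp_def, neg_neg] at b1 b2
      refine ⟨b1, b2, ?_⟩
      have c1 := hmp.integral_comp (Homeomorph.neg ℝ).measurableEmbedding (fun x => exp (q x))
      have c2 := hmp.integral_comp (Homeomorph.neg ℝ).measurableEmbedding (fun x => exp (- f x))
      rw [← c1, ← c2]; exact a3
  obtain ⟨a1, a2, a3⟩ := key (fun x => f x - f 0) (fun x => q x - f 0)
    (hf.add_const (-f 0)) (fun x y => by simpa using hlip x y) (by fun_prop)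
    (fun x y => by linarith [hq x y]) (by simp)
  have r1 : ∀ x, exp (q x) = exp (q x - f 0) * exp (f 0) := fun x => by
    rw [← Real.exp_add]; congr 1; ring
  have r2 : ∀ x, exp (-f x) = exp (-(f x - f 0)) * exp (-f 0) := fun x => by
    rw [← Real.exp_add]; congr 1; ring
  rw [show (fun x => exp (q x)) = fun x => exp (q x - f 0) * exp (f 0) from funext r1,
    show (fun x => exp (-f x)) = fun x => exp (-(f x - f 0)) * exp (-f 0) from funext r2]
  refine ⟨a1.mul_const _, a2.mul_const _, ?_⟩
  rw [integral_mul_const, integral_mul_const]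
  have r3 : exp (f 0) * exp (- f 0) = 1 := by rw [← Real.exp_add]; simp
  set A := ∫ x, exp (q x - f 0) ∂μ
  set B := ∫ x, exp (-(f x - f 0)) ∂μ
  have hA : 0 ≤ A := integral_nonneg fun x => (exp_pos _).le
  have hB : 0 ≤ B := integral_nonneg fun x => (exp_pos _).le
  calc A * exp (f 0) * (B * exp (- f 0)) = A * B * (exp (f 0) * exp (- f 0)) := by ring
    _ ≤ 1 := by rw [r3]; nlinarith [sq_nonneg (A - B)]

lemma cons_convex {n : ℕ} (z z' a b : ℝ) (x x' : Fin n → ℝ) :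
    (Fin.cons (a * z + b * z') (a • x + b • x') : Fin (n + 1) → ℝ) =
      a • (Fin.cons z x : Fin (n + 1) → ℝ) + b • (Fin.cons z' x' : Fin (n + 1) → ℝ) := by
  ext i
  refine Fin.cases ?_ (fun j => ?_) i <;> simp

lemma lipn_cont {n : ℕ} (C : ℝ) (hC : 0 < C) (f : (Fin n → ℝ) → ℝ)
    (hlip : ∀ x y, |f x - f y| ≤ (∑ i, |x i - y i|) / C) : Continuous f := by
  rw [continuous_iff_continuousAt]
  intro x
  have : Filter.Tendsto (fun y : Fin n → ℝ => (∑ i, |y i - x i|) / C) (nhds x) (nhds 0) := by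
    have hc : Continuous (fun y : Fin n → ℝ => (∑ i, |y i - x i|) / C) := by fun_prop
    simpa using hc.tendsto x
  rw [ContinuousAt, tendsto_iff_dist_tendsto_zero]
  exact squeeze_zero (fun _ => dist_nonneg) (fun y => by rw [Real.dist_eq]; exact hlip y x) this

lemma tensor_step_fun {n : ℕ} (C : ℝ) (hC : 0 < C) (f : (Fin (n + 1) → ℝ) → ℝ)
    (hf : ConvexOn ℝ univ f) (hlip : ∀ x y, |f x - f y| ≤ (∑ i, |x i - y i|) / C) :
    ∃ R : (Fin n → ℝ) → ℝ → ℝ,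
      (∀ x y z, R x y ≤ f (Fin.cons z x) + hub ((y - z) / C)) ∧
      (∀ x y c, (∀ z, c ≤ f (Fin.cons z x) + hub ((y - z) / C)) → c ≤ R x y) ∧
      (∀ x y x' y', R x y ≤ R x' y' + ((∑ i, |x i - x' i|) + |y - y'|) / C) ∧
      (∀ x y x' y' a b, 0 ≤ a → 0 ≤ b → a + b = 1 →
        R (a • x + b • x') (a * y + b * y') ≤ a * R x y + b * R x' y') := by
  have hbdd : ∀ x y, BddBelow (range fun z => f (Fin.cons z x) + hub ((y - z) / C)) := by
    intro x y
    refine ⟨f (Fin.cons y x) - 1 / 2, ?_⟩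
    rintro _ ⟨z, rfl⟩
    have h1 := (le_abs_self _).trans (hlip (Fin.cons y x) (Fin.cons z x))
    rw [Fin.sum_univ_succ] at h1
    simp only [Fin.cons_zero, Fin.cons_succ, sub_self, abs_zero, Finset.sum_const_zero, add_zero] at h1
    have h2 := hub_lin ((y - z) / C)
    rw [abs_div, abs_of_pos hC] at h2
    simp only
    linarith
  refine ⟨fun x y => ⨅ z, (f (Fin.cons z x) + hub ((y - z) / C)),
    fun x y z => ciInf_le (hbdd x y) z, fun x y c hc => le_ciInf hc, ?_, ?_⟩
  · intro x y x' y'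
    rw [← sub_le_iff_le_add]
    refine le_ciInf fun z => ?_
    rw [sub_le_iff_le_add]
    refine (ciInf_le (hbdd x y) z).trans ?_
    have h1 := (le_abs_self _).trans (hlip (Fin.cons z x) (Fin.cons z x'))
    rw [Fin.sum_univ_succ] at h1
    simp only [Fin.cons_zero, Fin.cons_succ, sub_self, abs_zero, zero_add] at h1
    have h2 := hub_lip ((y - z) / C) ((y' - z) / C)
    rw [← sub_div, abs_div, abs_of_pos hC, show y - z - (y' - z) = y - y' by ring] at h2
    rw [add_div]
    linarith
  · intro x y x' y' a b ha hb hab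
    refine le_of_forall_pos_le_add fun ε hε => ?_
    obtain ⟨z, hz⟩ := exists_lt_of_ciInf_lt (lt_add_of_pos_right
      (⨅ z, (f (Fin.cons z x) + hub ((y - z) / C))) hε)
    obtain ⟨z', hz'⟩ := exists_lt_of_ciInf_lt (lt_add_of_pos_right
      (⨅ z, (f (Fin.cons z x') + hub ((y' - z) / C))) hε)
    refine (ciInf_le (hbdd _ _) (a * z + b * z')).trans ?_
    rw [cons_convex]
    have h1 := hf.2 (mem_univ (Fin.cons z x)) (mem_univ (Fin.cons z' x')) ha hb hab
    simp only [smul_eq_mul] at h1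
    have h2 := hub_convex ((y - z) / C) ((y' - z') / C) a b ha hb hab
    rw [show a * ((y - z) / C) + b * ((y' - z') / C) = (a * y + b * y' - (a * z + b * z')) / C by ring] at h2
    have h3 := mul_le_mul_of_nonneg_left hz.le ha
    have h4 := mul_le_mul_of_nonneg_left hz'.le hb
    have h5 : a * ε + b * ε = ε := by rw [← add_mul, hab, one_mul]
    rw [mul_add, mul_add] at h3 h4
    linarith

lemma lintegral_cons {n : ℕ} (μ : Fin (n + 1) → Measure ℝ) (hμ : ∀ i, IsProbabilityMeasure (μ i))
    (F : (Fin (n + 1) → ℝ) → ENNReal) (hF : Measurable F) :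
    ∫⁻ x, F x ∂(Measure.pi μ) =
      ∫⁻ x, ∫⁻ y, F (Fin.cons y x) ∂(μ 0) ∂(Measure.pi fun j : Fin n => μ j.succ) := by
  have hmp := (measurePreserving_piFinSuccAbove μ 0).symm
  rw [← hmp.lintegral_comp hF, lintegral_prod_symm]
  · simp [MeasurableEquiv.piFinSuccAbove]
    rfl
  · exact (hF.comp (MeasurableEquiv.measurable _)).aemeasurable

set_option maxHeartbeats 1000000 in
lemma tensor (h l : ℝ) (hh : 0 < h) (hl0 : 0 ≤ l) (hl1 : l < 1)
    (C : ℝ) (hC : C = 17 * h / (1 - l) ^ 2) : ∀ (n : ℕ) (μ : Fin n → Measure ℝ)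
    (_ : ∀ i, IsProbabilityMeasure (μ i)) (_ : ∀ i, (μ i).map (fun x => -x) = μ i)
    (_ : ∀ i, ∀ x : ℝ, 0 ≤ x →
      (μ i) (Set.Ici (x + h)) ≤ ENNReal.ofReal l * (μ i) (Set.Ici x))
    (f : (Fin n → ℝ) → ℝ) (_ : ConvexOn ℝ univ f)
    (_ : ∀ x y, |f x - f y| ≤ (∑ i, |x i - y i|) / C)
    (E : (Fin n → ℝ) → ENNReal) (_ : Measurable E)
    (_ : ∀ x y, E x ≤ ENNReal.ofReal (exp (f y + ∑ i, hub ((x i - y i) / C)))),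
    (∫⁻ x, E x ∂(Measure.pi μ)) * ∫⁻ x, ENNReal.ofReal (exp (- f x)) ∂(Measure.pi μ) ≤ 1 := by
  have hk : 0 < 1 - l := by linarith
  have hCpos : 0 < C := by rw [hC]; positivity
  intro n
  induction n with
  | zero =>
    intro μ hμ _ _ f _ _ E hE hle
    have h1 : ∫⁻ x, E x ∂(Measure.pi μ) ≤ ENNReal.ofReal (exp (f default)) := by
      calc ∫⁻ x, E x ∂(Measure.pi μ) ≤ ∫⁻ x, ENNReal.ofReal (exp (f default)) ∂(Measure.pi μ) :=
            lintegral_mono fun x => (hle x default).trans (by simp)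
        _ = _ := by simp
    have h2 : ∫⁻ x, ENNReal.ofReal (exp (- f x)) ∂(Measure.pi μ) = ENNReal.ofReal (exp (- f default)) := by
      have : ∀ x : Fin 0 → ℝ, x = default := fun x => Subsingleton.elim _ _
      calc _ = ∫⁻ x, ENNReal.ofReal (exp (- f default)) ∂(Measure.pi μ) :=
            lintegral_congr fun x => by rw [this x]
        _ = _ := by simp
    rw [h2]
    calc _ ≤ ENNReal.ofReal (exp (f default)) * ENNReal.ofReal (exp (- f default)) := by gcongr
      _ = 1 := by rw [← ENNReal.ofReal_mul (exp_pos _).le, ← Real.exp_add]; simp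
  | succ n ih =>
    intro μ hμ hsym htail f hf hlip E hE hle
    have hfc := lipn_cont C hCpos f hlip
    obtain ⟨R, R1, R2, R3, R4⟩ := tensor_step_fun C hCpos f hf hlip
    have hRl : ∀ x y y', |R x y - R x y'| ≤ |y - y'| / C := fun x y y' => by
      have h1 := R3 x y x y'
      have h2 := R3 x y' x y
      simp only [sub_self, abs_zero, Finset.sum_const_zero, zero_add] at h1 h2
      rw [abs_sub_comm y' y] at h2
      rw [abs_le]; constructor <;> linarith
    have hRc : ∀ x, Continuous (R x) := fun x => lip_cont C hCpos _ (hRl x)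
    have hone : ∀ x, Integrable (fun y => exp (R x y)) (μ 0) ∧
        Integrable (fun y => exp (- f (Fin.cons y x))) (μ 0) ∧
        (∫ y, exp (R x y) ∂(μ 0)) * ∫ y, exp (- f (Fin.cons y x)) ∂(μ 0) ≤ 1 := fun x => by
      refine one_dim (μ 0) h l hh hl0 hl1 (hsym 0) (htail 0) C hC (fun y => f (Fin.cons y x)) (R x)
        ?_ ?_ (hRc x).measurable (fun y z => R1 x y z)
      · refine ⟨convex_univ, fun y _ y' _ a b ha hb hab => ?_⟩
        have h1 := hf.2 (mem_univ (Fin.cons y x)) (mem_univ (Fin.cons y' x)) ha hb hab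
        rw [← cons_convex, ← add_smul, hab, one_smul] at h1
        exact h1
      · intro y z
        have h1 := hlip (Fin.cons y x) (Fin.cons z x)
        rw [Fin.sum_univ_succ] at h1
        simpa using h1
    set g : (Fin n → ℝ) → ℝ := fun x => log (∫ y, exp (R x y) ∂(μ 0)) with hg
    have hgpos : ∀ x, 0 < ∫ y, exp (R x y) ∂(μ 0) := fun x => integral_exp_pos (hone x).1
    have hge : ∀ x, exp (g x) = ∫ y, exp (R x y) ∂(μ 0) := fun x => Real.exp_log (hgpos x)
    have hgl : ∀ x x', g x ≤ g x' + (∑ i, |x i - x' i|) / C := fun x x' => by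
      rw [← Real.exp_le_exp, Real.exp_add, hge, hge, ← integral_mul_const]
      refine integral_mono (hone x).1 ((hone x').1.mul_const _) fun y => ?_
      simp only
      rw [← Real.exp_add, Real.exp_le_exp]
      simpa using R3 x y x' y
    have hglip : ∀ x x', |g x - g x'| ≤ (∑ i, |x i - x' i|) / C := fun x x' => by
      have h1 := hgl x x'
      have h2 := hgl x' x
      simp only [abs_sub_comm (x' _) (x _)] at h2
      rw [abs_le]; constructor <;> linarith
    have hgconv : ConvexOn ℝ univ g := by
      refine ⟨convex_univ, fun x _ x' _ a b ha hb hab => ?_⟩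
      simp only [smul_eq_mul]
      rw [← Real.exp_le_exp, hge]
      set s := a * g x + b * g x' with hs
      have hpt : ∀ y, exp (R (a • x + b • x') y) ≤
          exp s * (a * (exp (R x y) * exp (- g x)) + b * (exp (R x' y) * exp (- g x'))) := fun y => by
        have h1 := R4 x y x' y a b ha hb hab
        rw [← add_mul, hab, one_mul] at h1
        have h2 := cvx2 convexOn_exp (R x y - g x) (R x' y - g x') a b ha hb hab
        rw [← Real.exp_add, ← Real.exp_add]
        calc exp (R (a • x + b • x') y) ≤ exp (s + (a * (R x y - g x) + b * (R x' y - g x'))) := by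
              rw [Real.exp_le_exp, hs]; linarith
          _ = exp s * exp (a * (R x y - g x) + b * (R x' y - g x')) := Real.exp_add _ _
          _ ≤ _ := by
              refine mul_le_mul_of_nonneg_left ?_ (exp_pos _).le
              simpa only [sub_eq_add_neg] using h2
      have i1 := ((hone x).1.mul_const (exp (- g x))).const_mul a
      have i2 := ((hone x').1.mul_const (exp (- g x'))).const_mul b
      refine (integral_mono (hone _).1 ((i1.add i2).const_mul (exp s)) hpt).trans_eq ?_
      rw [integral_const_mul]
      simp only [Pi.add_apply]
      rw [integral_add i1 i2, integral_const_mul, integral_const_mul, integral_mul_const,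
        integral_mul_const, ← hge, ← hge, ← Real.exp_add, ← Real.exp_add]
      simp [hab]
    have hconsm : Measurable (fun z : (Fin n → ℝ) × ℝ => (Fin.cons z.2 z.1 : Fin (n + 1) → ℝ)) := by
      rw [measurable_pi_iff]
      intro i
      refine Fin.cases ?_ (fun j => ?_) i
      · simpa using measurable_snd
      · simp only [Fin.cons_succ]
        exact (measurable_pi_apply j).comp measurable_fst
    have hcons' : ∀ x : Fin n → ℝ, Measurable (fun y : ℝ => (Fin.cons y x : Fin (n + 1) → ℝ)) := fun x =>
      hconsm.comp (measurable_const.prodMk measurable_id)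
    have hIH := ih (fun j => μ j.succ) (fun j => hμ _) (fun j => hsym _) (fun j => htail _) g hgconv hglip
      (fun x => ∫⁻ y, E (Fin.cons y x) ∂(μ 0)) ((hE.comp hconsm).lintegral_prod_right') (by
        intro x z
        set S := ∑ i, hub ((x i - z i) / C) with hS
        have hpt : ∀ y, E (Fin.cons y x) ≤ ENNReal.ofReal (exp (R z y) * exp S) := fun y => by
          have hw : ∀ w, E (Fin.cons y x) ≤ ENNReal.ofReal (exp (f (Fin.cons w z) + (hub ((y - w) / C) + S))) := by
            intro w
            have := hle (Fin.cons y x) (Fin.cons w z)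
            rw [Fin.sum_univ_succ] at this
            simpa using this
          have hfin : E (Fin.cons y x) ≠ ⊤ := ne_top_of_le_ne_top ENNReal.ofReal_ne_top (hw 0)
          by_cases h0 : E (Fin.cons y x) = 0
          · rw [h0]; exact zero_le
          have htr : 0 < (E (Fin.cons y x)).toReal := ENNReal.toReal_pos h0 hfin
          have : log (E (Fin.cons y x)).toReal - S ≤ R z y := R2 z y _ fun w => by
            have h1 := ENNReal.toReal_mono ENNReal.ofReal_ne_top (hw w)
            rw [ENNReal.toReal_ofReal (exp_pos _).le, ← Real.log_le_iff_le_exp htr] at h1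
            linarith
          rw [← Real.exp_add, ← ENNReal.ofReal_toReal hfin]
          apply ENNReal.ofReal_le_ofReal
          rw [← Real.log_le_iff_le_exp htr]; linarith
        refine (lintegral_mono hpt).trans ?_
        rw [← ofReal_integral_eq_lintegral_ofReal ((hone z).1.mul_const _)
          (Filter.Eventually.of_forall fun y => by positivity), integral_mul_const, ← hge, ← Real.exp_add])
    rw [lintegral_cons μ hμ E hE, lintegral_cons μ hμ _ (by fun_prop)]
    refine le_trans ?_ hIH
    gcongr with x
    rw [← ofReal_integral_eq_lintegral_ofReal (hone x).2.1
          (Filter.Eventually.of_forall fun y => by positivity)]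
    apply ENNReal.ofReal_le_ofReal
    have h1 := (hone x).2.2
    rw [← hge, mul_comm] at h1
    rw [Real.exp_neg, ← one_div, le_div_iff₀ (exp_pos _)]
    exact h1

lemma cost_bound (n : ℕ) (C : ℝ) (hC : 0 < C) (f : (Fin n → ℝ) → ℝ)
    (a b : ℝ) (ha : 0 < a) (hb : 0 < b)
    (hlip2 : ∀ x y : Fin n → ℝ, |f x - f y| ≤ a * Real.sqrt (∑ i, (x i - y i) ^ 2))
    (hlip1 : ∀ x y : Fin n → ℝ, |f x - f y| ≤ b * ∑ i, |x i - y i|)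
    (x y : Fin n → ℝ) (T : ℝ) (hT : 0 ≤ T) (hTf : C * T ≤ f x - f y) :
    T / b / 8 ≤ ∑ i, hub ((x i - y i) / C) ∨ T ^ 2 / a ^ 2 / 8 ≤ ∑ i, hub ((x i - y i) / C) := by
  classical
  set u : Fin n → ℝ := fun i => (x i - y i) / C with hu
  have hxy : ∀ i, x i - y i = C * u i := fun i => by simp only [hu]; field_simp
  set z : Fin n → ℝ := fun i => if |u i| ≤ 1 then y i else x i with hz
  set S := ∑ i, (if |u i| ≤ 1 then u i ^ 2 else 0) with hS
  set V := ∑ i, (if |u i| ≤ 1 then 0 else |u i|) with hV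
  have hS0 : 0 ≤ S := Finset.sum_nonneg fun i _ => by split_ifs <;> positivity
  have h1 : f x - f z ≤ a * (C * Real.sqrt S) := by
    refine ((le_abs_self _).trans (hlip2 x z)).trans_eq ?_
    have : ∑ i, (x i - z i) ^ 2 = C ^ 2 * S := by
      rw [hS, Finset.mul_sum]
      refine Finset.sum_congr rfl fun i _ => ?_
      simp only [hz]
      split_ifs
      · rw [hxy]; ring
      · ring
    rw [this, Real.sqrt_mul (by positivity), Real.sqrt_sq hC.le]
  have h2 : f z - f y ≤ b * (C * V) := by
    refine ((le_abs_self _).trans (hlip1 z y)).trans_eq ?_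
    congr 1
    rw [hV, Finset.mul_sum]
    refine Finset.sum_congr rfl fun i _ => ?_
    simp only [hz]
    split_ifs
    · simp
    · rw [hxy, abs_mul, abs_of_pos hC]
  have h3 : T ≤ a * Real.sqrt S + b * V := by
    have : C * T ≤ C * (a * Real.sqrt S + b * V) := by linarith
    exact le_of_mul_le_mul_left this hC
  have hV0 : 0 ≤ V := Finset.sum_nonneg fun i _ => by split_ifs <;> positivity
  have h4 : S / 2 + V / 2 ≤ ∑ i, hub (u i) := by
    rw [hS, hV, Finset.sum_div, Finset.sum_div, ← Finset.sum_add_distrib]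
    refine Finset.sum_le_sum fun i _ => ?_
    unfold hub
    split_ifs with hi
    · linarith
    · push Not at hi; linarith
  change T / b / 8 ≤ ∑ i, hub (u i) ∨ T ^ 2 / a ^ 2 / 8 ≤ ∑ i, hub (u i)
  by_cases hc : T / 2 ≤ b * V
  · left
    have : T / b / 2 ≤ V := by
      rw [div_div, div_le_iff₀ (by positivity)]; linarith
    have hTb : 0 ≤ T / b := by positivity
    linarith
  · right
    push Not at hc
    have h5 : T / 2 ≤ a * Real.sqrt S := by linarith
    have h6 : (T / 2) ^ 2 ≤ (a * Real.sqrt S) ^ 2 := pow_le_pow_left₀ (by positivity) h5 2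
    rw [mul_pow, Real.sq_sqrt hS0] at h6
    have : T ^ 2 / a ^ 2 ≤ 4 * S := by
      rw [div_le_iff₀ (by positivity)]; linarith
    linarith

lemma min_bound (a b t s c : ℝ) (ha : 0 < a) (hb : 0 < b) (ht : 0 ≤ t) (hs : 0 ≤ s) (hc : 0 ≤ c)
    (hcost : s ≤ t → (t - s) / b / 8 ≤ c ∨ (t - s) ^ 2 / a ^ 2 / 8 ≤ c) :
    1 / 8 * min (t / b) (t ^ 2 / a ^ 2) ≤ s / b + c := by
  have m1 := min_le_left (t / b) (t ^ 2 / a ^ 2)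
  have m2 := min_le_right (t / b) (t ^ 2 / a ^ 2)
  have hsb : 0 ≤ s / b := by positivity
  have htb : 0 ≤ t / b := by positivity
  by_cases hst : s ≤ t / 2
  swap
  · push Not at hst
    have : t / 2 / b ≤ s / b := by gcongr
    have e : t / 2 / b = t / b / 2 := by ring
    linarith
  rcases hcost (by linarith) with h | h
  · rw [sub_div] at h
    linarith
  · by_cases h4 : t / a ^ 2 ≤ 4 / b
    · have e1 : (t - s) ^ 2 / a ^ 2 = t ^ 2 / a ^ 2 - 2 * s * (t / a ^ 2) + s ^ 2 / a ^ 2 := by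
        field_simp; ring
      have e2 : 2 * s * (t / a ^ 2) ≤ 2 * s * (4 / b) := by gcongr
      have e3 : 2 * s * (4 / b) = 8 * (s / b) := by ring
      have e4 : 0 ≤ s ^ 2 / a ^ 2 := by positivity
      rw [e1] at h
      linarith
    · push Not at h4
      have e1 : (t / 2) ^ 2 / a ^ 2 ≤ (t - s) ^ 2 / a ^ 2 := by
        gcongr; linarith
      have e2 : (t / 2) ^ 2 / a ^ 2 = t / 4 * (t / a ^ 2) := by ring
      have e3 : t / 4 * (4 / b) ≤ t / 4 * (t / a ^ 2) := by gcongr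
      have e4 : t / 4 * (4 / b) = t / b := by ring
      linarith

theorem stmt15 (n : ℕ) (μ : Fin n → Measure ℝ) [∀ i, IsProbabilityMeasure (μ i)]
    (h l : ℝ) (hh : 0 < h) (hl0 : 0 ≤ l) (hl1 : l < 1)
    (hsym : ∀ i, (μ i).map (fun x => -x) = μ i)
    (htail : ∀ i, ∀ x : ℝ, 0 ≤ x →
      (μ i) (Set.Ici (x + h)) ≤ ENNReal.ofReal l * (μ i) (Set.Ici x))
    (Cτ : ℝ) (hCτ : Cτ = 17 * h / (1 - l) ^ 2)
    (f : (Fin n → ℝ) → ℝ) (hconv : ConvexOn ℝ Set.univ f)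
    (a b : ℝ) (ha : 0 < a) (hb : 0 < b)
    (hlip2 : ∀ x y : Fin n → ℝ, |f x - f y| ≤ a * Real.sqrt (∑ i, (x i - y i) ^ 2))
    (hlip1 : ∀ x y : Fin n → ℝ, |f x - f y| ≤ b * ∑ i, |x i - y i|)
    (m : ℝ)
    (hmed1 : ENNReal.ofReal (1 / 2) ≤ Measure.pi μ {x | f x ≤ m})
    (hmed2 : ENNReal.ofReal (1 / 2) ≤ Measure.pi μ {x | m ≤ f x}) :
    ∀ t : ℝ, 0 ≤ t →
      Measure.pi μ {x | f x < m - Cτ * t} ≤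
        ENNReal.ofReal (2 * Real.exp (-(1 / 8) * min (t / b) (t ^ 2 / a ^ 2))) := by
  intro t ht
  have hk : 0 < 1 - l := by linarith
  have hC : 0 < Cτ := by rw [hCτ]; positivity
  have hfc : Continuous f := lipn_cont (1 / b) (by positivity) f fun x y => by
    refine (hlip1 x y).trans_eq ?_
    field_simp
  set M := 1 / 8 * min (t / b) (t ^ 2 / a ^ 2) with hM
  set F : (Fin n → ℝ) → ℝ := fun x => 1 / (b * Cτ) * max (f x - (m - Cτ * t)) 0 with hF
  have hbC : 0 < 1 / (b * Cτ) := by positivity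
  have hFconv : ConvexOn ℝ univ F := by
    have h1 : ConvexOn ℝ univ (fun x => max (f x - (m - Cτ * t)) 0) :=
      (hconv.add_const (-(m - Cτ * t))).sup (convexOn_const 0 convex_univ)
    exact h1.smul hbC.le
  have hFlip : ∀ x y, |F x - F y| ≤ (∑ i, |x i - y i|) / Cτ := fun x y => by
    simp only [hF]
    rw [← mul_sub, abs_mul, abs_of_pos hbC]
    have h1 : |max (f x - (m - Cτ * t)) 0 - max (f y - (m - Cτ * t)) 0| ≤ b * ∑ i, |x i - y i| := by
      refine (abs_max_sub_max_le_abs _ _ _).trans ?_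
      simpa using hlip1 x y
    calc _ ≤ 1 / (b * Cτ) * (b * ∑ i, |x i - y i|) := by gcongr
      _ = _ := by field_simp
  have hms : MeasurableSet {x | m ≤ f x} := measurableSet_le measurable_const hfc.measurable
  have hms2 : MeasurableSet {x | f x < m - Cτ * t} := measurableSet_lt hfc.measurable measurable_const
  have key := tensor h l hh hl0 hl1 Cτ hCτ n μ inferInstance hsym htail F hFconv hFlip
    ({x | m ≤ f x}.indicator fun _ => ENNReal.ofReal (exp M)) (measurable_const.indicator hms) (by
      intro x y
      by_cases hx : x ∈ {x | m ≤ f x}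
      swap
      · rw [indicator_of_notMem hx]; exact zero_le
      rw [indicator_of_mem hx]
      apply ENNReal.ofReal_le_ofReal
      rw [Real.exp_le_exp]
      have hx : m ≤ f x := hx
      have := min_bound a b t (max (f y - (m - Cτ * t)) 0 / Cτ) (∑ i, hub ((x i - y i) / Cτ)) ha hb ht
        (by positivity) (Finset.sum_nonneg fun i _ => hub_nonneg _)
        (fun hs => cost_bound n Cτ hC f a b ha hb hlip2 hlip1 x y _ (by linarith) (by
          have e : Cτ * (t - max (f y - (m - Cτ * t)) 0 / Cτ) = Cτ * t - max (f y - (m - Cτ * t)) 0 := by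
            field_simp
          rw [e]
          linarith [le_max_left (f y - (m - Cτ * t)) 0]))
      rw [← hM] at this
      refine this.trans_eq ?_
      simp only [hF]
      congr 1
      field_simp)
  rw [lintegral_indicator hms, setLIntegral_const] at key
  have h1 : Measure.pi μ {x | f x < m - Cτ * t} ≤ ∫⁻ x, ENNReal.ofReal (exp (- F x)) ∂(Measure.pi μ) := by
    rw [← lintegral_indicator_one hms2]
    refine lintegral_mono fun x => ?_
    by_cases hx : x ∈ {x | f x < m - Cτ * t}
    · rw [indicator_of_mem hx]
      have hx : f x < m - Cτ * t := hx
      simp only [hF]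
      rw [max_eq_right (by linarith)]
      simp
    · rw [indicator_of_notMem hx]; exact zero_le
  set P := Measure.pi μ {x | f x < m - Cτ * t} with hP
  have hPfin : P ≠ ⊤ := measure_ne_top _ _
  have h2 : ENNReal.ofReal (exp M) * ENNReal.ofReal (1 / 2) * P ≤ 1 :=
    le_trans (by gcongr) key
  rw [← ENNReal.ofReal_toReal hPfin, ← ENNReal.ofReal_mul (exp_pos _).le,
    ← ENNReal.ofReal_mul (by positivity), ENNReal.ofReal_le_one] at h2
  rw [← ENNReal.ofReal_toReal hPfin]
  apply ENNReal.ofReal_le_ofReal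
  rw [show -(1 / 8) * min (t / b) (t ^ 2 / a ^ 2) = - M by rw [hM]; ring, Real.exp_neg,
    ← div_eq_mul_inv, le_div_iff₀ (exp_pos _)]
  linarith
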